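/- Let H be a finitely generated free abelian group and V ⊆ H a primitive subgroup (i.e. the quotient H/V is torsion-free). Let H* = Hom_ℤ(H, ℤ), and let M^st = Λ*(H*) ⊗_ℤ ℤ[U, U⁻¹], on which each v ∈ H acts by the ℤ[U,U⁻¹]-linear endomorphism ι_v ⊗ id, where ι_v is the interior product on Λ*(H*) by the evaluation functional ⟨−, v⟩. Let K^V(M^st) = {x ∈ M^st | (ι_v ⊗ id)(x) = 0 for all v ∈ V}, a ℤ[U,U⁻¹]-submodule preserved by the action of every w ∈ H. Then the quotient QK^V(M^st) of K^V(M^st) by the additive subgroup generated by {(ι_w ⊗ id)(y) | w ∈ H, y ∈ K^V(M^st)} is isomorphic, as a ℤ[U,U⁻¹]-module, to ℤ[U,U⁻¹] (i.e. it is free of rank one over the Laurent polynomial ring). -/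

import Mathlib

open TensorProduct

/-- The interior product (left contraction) on the exterior algebra `Λ*(H*)` over `ℤ`
by the evaluation functional `⟨−, v⟩ ∈ (H*)*` determined by `v ∈ H`. -/
noncomputable def dualContraction (H : Type*) [AddCommGroup H] [Module ℤ H] (v : H) :
    ExteriorAlgebra ℤ (Module.Dual ℤ H) →ₗ[ℤ] ExteriorAlgebra ℤ (Module.Dual ℤ H) :=
  CliffordAlgebra.contractLeft (Q := (0 : QuadraticForm ℤ (Module.Dual ℤ H)))
    (Module.Dual.eval ℤ H v)

/-- The standard module `M^st = Λ*(H*) ⊗_ℤ ℤ[U,U⁻¹]`, realized as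
`ℤ[U,U⁻¹] ⊗_ℤ Λ*(H*)` so that it carries its `ℤ[U,U⁻¹]`-module structure. -/
noncomputable abbrev Mst (H : Type*) [AddCommGroup H] [Module ℤ H] : Type _ :=
  LaurentPolynomial ℤ ⊗[ℤ] ExteriorAlgebra ℤ (Module.Dual ℤ H)

/-- The `ℤ[U,U⁻¹]`-linear action `ι_v ⊗ id` of `v ∈ H` on `M^st`. -/
noncomputable def MstAct (H : Type*) [AddCommGroup H] [Module ℤ H] (v : H) :
    Mst H →ₗ[LaurentPolynomial ℤ] Mst H :=
  LinearMap.baseChange (LaurentPolynomial ℤ) (dualContraction H v)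

/-- Annihilation operators `c i` and creation operators `a i` on a module satisfying the
canonical anticommutation relations. -/
structure IsFermionic {R M ι : Type*} [CommRing R] [AddCommGroup M] [Module R M]
    (c a : ι → M →ₗ[R] M) : Prop where
  c_c : ∀ i j x, c i (c j x) = -c j (c i x)
  c_self : ∀ i x, c i (c i x) = 0
  a_a : ∀ i j x, a i (a j x) = -a j (a i x)
  a_self : ∀ i x, a i (a i x) = 0
  c_a : ∀ i j x, i ≠ j → c i (a j x) = -a j (c i x)
  c_a_self : ∀ i x, c i (a i x) = x - a i (c i x)

namespace IsFermionic

variable {R M ι : Type*} [CommRing R] [AddCommGroup M] [Module R M] {c a : ι → M →ₗ[R] M}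

/-- The successive projections `c i ∘ a i` for `i` in a list. -/
def vacProj (c a : ι → M →ₗ[R] M) : List ι → M →ₗ[R] M
  | [] => LinearMap.id
  | i :: l => c i ∘ₗ a i ∘ₗ vacProj c a l

/-- The ordered product of the creation operators indexed by a list. -/
def create (a : ι → M →ₗ[R] M) : List ι → M →ₗ[R] M
  | [] => LinearMap.id
  | i :: l => a i ∘ₗ create a l

/-- The product, in the opposite order, of the annihilation operators indexed by a list. -/
def annihilate (c : ι → M →ₗ[R] M) : List ι → M →ₗ[R] M
  | [] => LinearMap.id
  | i :: l => annihilate c l ∘ₗ c i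

theorem vacProj_of_forall_eq_zero (h : IsFermionic c a) (l : List ι) {z : M}
    (hz : ∀ i, c i z = 0) : vacProj c a l z = z := by
  induction l with
  | nil => rfl
  | cons i l ih => simp [vacProj, ih, h.c_a_self, hz]

theorem vacProj_a_of_notMem (h : IsFermionic c a) {l : List ι} {j : ι} (hj : j ∉ l) (x : M) :
    vacProj c a l (a j x) = a j (vacProj c a l x) := by
  induction l with
  | nil => rfl
  | cons i l ih =>
    simp only [List.mem_cons, not_or] at hj
    simp [vacProj, ih hj.2, h.a_a i j, h.c_a i j _ (Ne.symm hj.1)]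

theorem vacProj_a_of_mem (h : IsFermionic c a) {l : List ι} {j : ι} (hj : j ∈ l) (x : M) :
    vacProj c a l (a j x) = 0 := by
  induction l with
  | nil => simp at hj
  | cons i l ih =>
    by_cases hl : j ∈ l
    · simp [vacProj, ih hl]
    · obtain rfl : j = i := by simpa [hl] using hj
      simp [vacProj, h.vacProj_a_of_notMem hl, h.a_self]

theorem c_create_eq_zero (h : IsFermionic c a) {l : List ι} {j : ι} (hj : j ∉ l) {x : M}
    (hx : c j x = 0) : c j (create a l x) = 0 := by
  induction l with
  | nil => exact hx
  | cons i l ih =>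
    simp only [List.mem_cons, not_or] at hj
    simp [create, h.c_a j i _ hj.1, ih hj.2]

theorem c_annihilate_eq_zero (h : IsFermionic c a) (l : List ι) {j : ι} {x : M}
    (hx : c j x = 0) : c j (annihilate c l x) = 0 := by
  induction l generalizing x with
  | nil => exact hx
  | cons i l ih => exact ih (by rw [h.c_c, hx, map_zero, neg_zero])

theorem c_annihilate_of_mem (h : IsFermionic c a) {l : List ι} {j : ι} (hj : j ∈ l) (x : M) :
    c j (annihilate c l x) = 0 := by
  induction l generalizing x with
  | nil => simp at hj
  | cons i l ih =>
    rcases List.mem_cons.1 hj with rfl | hl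
    · exact h.c_annihilate_eq_zero l (h.c_self j x)
    · exact ih hl _

theorem annihilate_c_of_mem (h : IsFermionic c a) {l : List ι} {j : ι} (hj : j ∈ l) (x : M) :
    annihilate c l (c j x) = 0 := by
  induction l generalizing x with
  | nil => simp at hj
  | cons i l ih =>
    rcases List.mem_cons.1 hj with rfl | hl
    · simp [annihilate, h.c_self]
    · simp [annihilate, h.c_c i j, ih hl]

theorem annihilate_create (h : IsFermionic c a) {l : List ι} (hl : l.Nodup) {z : M}
    (hz : ∀ i, c i z = 0) : annihilate c l (create a l z) = z := by
  induction l with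
  | nil => rfl
  | cons i l ih =>
    rw [List.nodup_cons] at hl
    simp [annihilate, create, h.c_a_self, h.c_create_eq_zero hl.1 (hz i), ih hl.2]

theorem a_create_annihilate (h : IsFermionic c a) {l : List ι} {j : ι} (hj : j ∉ l) (x : M) :
    a j (create a l (annihilate c l x)) = create a l (annihilate c l (a j x)) := by
  induction l generalizing x with
  | nil => rfl
  | cons i l ih =>
    simp only [List.mem_cons, not_or] at hj
    simp [create, annihilate, h.a_a j i, h.c_a i j _ (Ne.symm hj.1), ih hj.2]

/-- Modulo the images of the annihilation operators, a vector equals its component along the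
states in which every level of `l` is occupied. -/
theorem sub_create_annihilate_mem (h : IsFermionic c a) {K N : Submodule R M} {l : List ι}
    (hl : l.Nodup) (hcK : ∀ i ∈ l, ∀ x ∈ K, c i x ∈ K) (haK : ∀ i ∈ l, ∀ x ∈ K, a i x ∈ K)
    (hN : ∀ i ∈ l, ∀ x ∈ K, c i x ∈ N) {x : M} (hx : x ∈ K) :
    x - create a l (annihilate c l x) ∈ N := by
  induction l generalizing x with
  | nil => simp [create, annihilate]
  | cons i l ih =>
    rw [List.nodup_cons] at hl
    simp only [List.forall_mem_cons] at hcK haK hN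
    have h₁ := ih hl.2 hcK.2 haK.2 hN.2 (haK.1 _ (hcK.1 _ hx))
    have h₂ := hN.1 _ (haK.1 _ hx)
    have h₃ := N.add_mem h₁ h₂
    rw [h.c_a_self] at h₃
    simp only [create, annihilate, LinearMap.comp_apply]
    rw [h.a_create_annihilate hl.1]
    convert h₃ using 1
    abel

/-- For a Fock space with one-dimensional vacuum, the joint kernel `K` of the annihilation
operators in `m`, modulo the images of all annihilation operators, is free of rank one. -/
theorem nonempty_quotient_equiv {m n : Type*} [Finite n] {c a : m ⊕ n → M →ₗ[R] M}
    (h : IsFermionic c a) {vac : M} {ε : M →ₗ[R] R} (hvac : ∀ i, c i vac = 0) (hε : ε vac = 1)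
    (hker : ∀ z, (∀ i, c i z = 0) → z = ε z • vac)
    {K : Submodule R M} (hK : ∀ x, x ∈ K ↔ ∀ i, c (.inl i) x = 0) (N : Submodule R K)
    (hcN : ∀ i, ∀ x : K, ∀ y : K, (y : M) = c i x → y ∈ N)
    (hN : ∀ f : M →ₗ[R] R, (∀ i, ∀ x ∈ K, f (c i x) = 0) → ∀ y ∈ N, f y = 0) :
    Nonempty ((K ⧸ N) ≃ₗ[R] R) := by
  have := Fintype.ofFinite n
  let l : List (m ⊕ n) := Finset.univ.toList.map (Sum.inr : n → m ⊕ n)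
  have hl : l.Nodup := (Finset.nodup_toList _).map Sum.inr_injective
  have hinr (i : n) : Sum.inr i ∈ l := by simp [l]
  have hinl (i : m) : Sum.inl i ∉ l := by simp [l]
  have hcK (i) (x) (hx : x ∈ K) : c i x ∈ K := by
    rw [hK] at hx ⊢
    intro j
    rw [h.c_c, hx, map_zero, neg_zero]
  have haK (i) (hi : i ∈ l) (x) (hx : x ∈ K) : a i x ∈ K := by
    rw [hK] at hx ⊢
    intro j
    rw [h.c_a _ _ _ (by rintro rfl; exact hinl j hi), hx, map_zero, neg_zero]
  have hωK : create a l vac ∈ K := (hK _).2 fun i => h.c_create_eq_zero (hinl i) (hvac _)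
  let φ : K →ₗ[R] R := (ε ∘ₗ annihilate c l) ∘ₗ K.subtype
  have hφω : φ ⟨_, hωK⟩ = 1 := by
    simp [φ, h.annihilate_create hl hvac, hε]
  have hsurj : Function.Surjective φ := fun r => ⟨r • ⟨_, hωK⟩, by rw [map_smul, hφω]; simp⟩
  have hkerφ : LinearMap.ker φ = N := by
    apply le_antisymm
    · intro x hx
      have hz : annihilate c l (x : M) = 0 := by
        rw [hker (annihilate c l (x : M)), show ε (annihilate c l (x : M)) = 0 from hx, zero_smul]
        rintro (i | i)
        · exact h.c_annihilate_eq_zero l ((hK _).1 x.2 i)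
        · exact h.c_annihilate_of_mem (hinr i) _
      have := h.sub_create_annihilate_mem (K := K) (N := N.map K.subtype) hl
        (fun i _ => hcK i) haK
        (fun i _ y hy => ⟨⟨_, hcK i y hy⟩, hcN i ⟨y, hy⟩ _ rfl, rfl⟩) x.2
      rw [hz, map_zero, sub_zero] at this
      obtain ⟨y, hy, hyx⟩ := this
      rwa [← Subtype.ext hyx]
    · intro y hy
      refine hN (ε ∘ₗ annihilate c l) ?_ y hy
      rintro (i | i) x hx
      · rw [(hK x).1 hx, map_zero]
      · simp [h.annihilate_c_of_mem (hinr i)]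
  exact ⟨(Submodule.quotEquivOfEq _ _ hkerφ.symm).trans (φ.quotKerEquivOfSurjective hsurj)⟩

end IsFermionic

section Mst

variable {H : Type*} [AddCommGroup H] [Module ℤ H]

/-- Left exterior multiplication by `f ∈ H*` on `M^st`. -/
noncomputable def mstMul (f : Module.Dual ℤ H) : Mst H →ₗ[LaurentPolynomial ℤ] Mst H :=
  LinearMap.baseChange (LaurentPolynomial ℤ) (LinearMap.mulLeft ℤ (ExteriorAlgebra.ι ℤ f))

/-- The augmentation `M^st → ℤ[U,U⁻¹]`. -/
noncomputable def mstAug (H : Type*) [AddCommGroup H] [Module ℤ H] :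
    Mst H →ₗ[LaurentPolynomial ℤ] LaurentPolynomial ℤ :=
  (TensorProduct.AlgebraTensorModule.rid ℤ (LaurentPolynomial ℤ) (LaurentPolynomial ℤ)).toLinearMap ∘ₗ
    LinearMap.baseChange (LaurentPolynomial ℤ)
      (ExteriorAlgebra.algebraMapInv (R := ℤ) (M := Module.Dual ℤ H)).toLinearMap

@[simp] theorem mstAct_tmul (v : H) (s : LaurentPolynomial ℤ)
    (t : ExteriorAlgebra ℤ (Module.Dual ℤ H)) :
    MstAct H v (s ⊗ₜ t) = s ⊗ₜ dualContraction H v t := rfl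

@[simp] theorem mstMul_tmul (f : Module.Dual ℤ H) (s : LaurentPolynomial ℤ)
    (t : ExteriorAlgebra ℤ (Module.Dual ℤ H)) :
    mstMul f (s ⊗ₜ t) = s ⊗ₜ (ExteriorAlgebra.ι ℤ f * t) := rfl

theorem dualContraction_ι_mul (v : H) (f : Module.Dual ℤ H)
    (t : ExteriorAlgebra ℤ (Module.Dual ℤ H)) :
    dualContraction H v (ExteriorAlgebra.ι ℤ f * t) =
      f v • t - ExteriorAlgebra.ι ℤ f * dualContraction H v t :=
  CliffordAlgebra.contractLeft_ι_mul _ f t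

theorem mstAct_mstAct (v w : H) (x : Mst H) :
    MstAct H v (MstAct H w x) = -MstAct H w (MstAct H v x) := by
  induction x using TensorProduct.induction_on with
  | zero => simp
  | add x y hx hy => simp only [map_add, hx, hy, neg_add]
  | tmul s t =>
    simp only [mstAct_tmul, ← TensorProduct.tmul_neg]
    congr 1
    exact CliffordAlgebra.contractLeft_comm _ _ t

theorem mstAct_self (v : H) (x : Mst H) : MstAct H v (MstAct H v x) = 0 := by
  induction x using TensorProduct.induction_on with
  | zero => simp
  | add x y hx hy => simp only [map_add, hx, hy, add_zero]
  | tmul s t =>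
    simp only [mstAct_tmul]
    rw [show dualContraction H v (dualContraction H v t) = 0 from
      CliffordAlgebra.contractLeft_contractLeft _ t, TensorProduct.tmul_zero]

theorem mstMul_self (f : Module.Dual ℤ H) (x : Mst H) : mstMul f (mstMul f x) = 0 := by
  induction x using TensorProduct.induction_on with
  | zero => simp
  | add x y hx hy => simp only [map_add, hx, hy, add_zero]
  | tmul s t => simp [← mul_assoc]

theorem mstMul_mstMul (f g : Module.Dual ℤ H) (x : Mst H) :
    mstMul f (mstMul g x) = -mstMul g (mstMul f x) := by
  induction x using TensorProduct.induction_on with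
  | zero => simp
  | add x y hx hy => simp only [map_add, hx, hy, neg_add]
  | tmul s t =>
    simp only [mstMul_tmul, ← TensorProduct.tmul_neg, ← mul_assoc, ← neg_mul]
    rw [eq_neg_of_add_eq_zero_left (ExteriorAlgebra.ι_add_mul_swap f g), neg_mul, neg_mul, neg_mul]

theorem mstAct_mstMul (v : H) (f : Module.Dual ℤ H) (x : Mst H) :
    MstAct H v (mstMul f x) = f v • x - mstMul f (MstAct H v x) := by
  induction x using TensorProduct.induction_on with
  | zero => simp
  | add x y hx hy => simp only [map_add, hx, hy, smul_add]; abel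
  | tmul s t =>
    simp only [mstMul_tmul, mstAct_tmul, dualContraction_ι_mul, TensorProduct.tmul_sub,
      TensorProduct.tmul_smul]

theorem isFermionic_mst {ι : Type*} [Finite ι] [DecidableEq ι] (b : Module.Basis ι ℤ H) :
    IsFermionic (fun i => MstAct H (b i)) (fun i => mstMul (b.dualBasis i)) where
  c_c _ _ := mstAct_mstAct _ _
  c_self _ := mstAct_self _
  a_a _ _ := mstMul_mstMul _ _
  a_self _ := mstMul_self _
  c_a i j x hij := by
    simp [mstAct_mstMul, hij]
  c_a_self i x := by simp [mstAct_mstMul]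

theorem mstAct_one (v : H) (s : LaurentPolynomial ℤ) : MstAct H v (s ⊗ₜ 1) = 0 := by
  rw [mstAct_tmul, show dualContraction H v 1 = 0 from CliffordAlgebra.contractLeft_one ..,
    TensorProduct.tmul_zero]

theorem mstAug_tmul_one (s : LaurentPolynomial ℤ) : mstAug H (s ⊗ₜ 1) = s := by
  simp [mstAug]

/-- The action on a fixed vector of `M^st`, as a linear map in `v ∈ H`. -/
noncomputable def mstOrbit (x : Mst H) : H →ₗ[ℤ] Mst H where
  toFun v := MstAct H v x
  map_add' v w := by
    simp [MstAct, dualContraction, LinearMap.baseChange_add]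
  map_smul' r v := by
    rw [MstAct, dualContraction, LinearMap.map_smul, LinearMap.map_smul, LinearMap.baseChange_smul]
    rfl

theorem mstMul_sum_smul {ι : Type*} (s : Finset ι) (r : ι → ℤ) (f : ι → Module.Dual ℤ H)
    (x : Mst H) :
    mstMul (∑ i ∈ s, r i • f i) x = ∑ i ∈ s, r i • mstMul (f i) x := by
  induction x using TensorProduct.induction_on with
  | zero => simp
  | add x y hx hy => simp only [map_add, hx, hy, smul_add, Finset.sum_add_distrib]
  | tmul p t =>
    simp only [mstMul_tmul, map_sum, map_smul, Finset.sum_mul, smul_mul_assoc,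
      TensorProduct.tmul_sum, TensorProduct.tmul_smul]

/-- The vectors of `M^st` annihilated by all of `H` are the scalars. -/
theorem eq_mstAug_smul {ι : Type*} [Finite ι] [DecidableEq ι] (b : Module.Basis ι ℤ H)
    {z : Mst H} (hz : ∀ i, MstAct H (b i) z = 0) :
    z = mstAug H z • ((1 : LaurentPolynomial ℤ) ⊗ₜ[ℤ] (1 : ExteriorAlgebra ℤ _)) := by
  have := Fintype.ofFinite ι
  have h := isFermionic_mst b
  let l : List ι := Finset.univ.toList
  suffices ∀ x : Mst H, IsFermionic.vacProj (fun i => MstAct H (b i))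
      (fun i => mstMul (b.dualBasis i)) l x =
        mstAug H x • ((1 : LaurentPolynomial ℤ) ⊗ₜ[ℤ] (1 : ExteriorAlgebra ℤ _)) by
    rw [← this, h.vacProj_of_forall_eq_zero l hz]
  intro x
  induction x using TensorProduct.induction_on with
  | zero => simp
  | add x y hx hy => simp only [map_add, hx, hy, add_smul]
  | tmul s t =>
    induction t using CliffordAlgebra.left_induction with
    | algebraMap r =>
      have hr : s ⊗ₜ[ℤ] algebraMap ℤ (ExteriorAlgebra ℤ (Module.Dual ℤ H)) r =
          (r • s) ⊗ₜ[ℤ] 1 := by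
        rw [Algebra.algebraMap_eq_smul_one, TensorProduct.smul_tmul]
      erw [hr]
      rw [h.vacProj_of_forall_eq_zero l fun i => mstAct_one _ _, mstAug_tmul_one,
        TensorProduct.smul_tmul', smul_eq_mul, mul_one]
    | add t u ht hu => simp only [TensorProduct.tmul_add, map_add, ht, hu, add_smul]
    | ι_mul t f _ =>
      have haug : mstAug H (mstMul f (s ⊗ₜ t)) = 0 := by
        have hf : ExteriorAlgebra.algebraMapInv (ExteriorAlgebra.ι ℤ f) = 0 := by
          simp [ExteriorAlgebra.algebraMapInv]
        simp [mstAug, hf]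
      change IsFermionic.vacProj _ _ l (mstMul f (s ⊗ₜ t)) = mstAug H (mstMul f (s ⊗ₜ t)) • _
      rw [haug, zero_smul, ← b.dualBasis.sum_repr f, mstMul_sum_smul, map_sum]
      refine Finset.sum_eq_zero fun i _ => ?_
      rw [map_zsmul, h.vacProj_a_of_mem (by simp [l]), smul_zero]

end Mst

theorem Submodule.exists_basis_sum_span_inl_eq {R M : Type*} [CommRing R] [IsDomain R]
    [IsPrincipalIdealRing R] [AddCommGroup M] [Module R M] [Module.Free R M] [Module.Finite R M]
    (V : Submodule R M) [Module.IsTorsionFree R (M ⧸ V)] :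
    ∃ (m n : ℕ) (b : Module.Basis (Fin m ⊕ Fin n) R M),
      Submodule.span R (Set.range (b ∘ Sum.inl)) = V := by
  let bV := Module.finBasis R V
  let bQ := Module.finBasis R (M ⧸ V)
  refine ⟨_, _, bV.sumQuot bQ, ?_⟩
  have : bV.sumQuot bQ ∘ Sum.inl = V.subtype ∘ bV := by ext i; simp
  rw [this, Set.range_comp, Submodule.span_image, bV.span_eq, Submodule.map_top,
    Submodule.range_subtype]

/-- Let `H` be a finitely generated free abelian group and `V ⊆ H` a
primitive subgroup (`H/V` torsion-free). Let `K^V(M^st)` be the kernel of the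
`V`-action on `M^st = Λ*(H*) ⊗_ℤ ℤ[U,U⁻¹]` (a `ℤ[U,U⁻¹]`-submodule preserved by the
action of every `w ∈ H`). Then the quotient `QK^V(M^st)` of `K^V(M^st)` by the additive
subgroup generated by `{(ι_w ⊗ id)(y) | w ∈ H, y ∈ K^V(M^st)}` is isomorphic, as a
`ℤ[U,U⁻¹]`-module, to `ℤ[U,U⁻¹]`. -/
theorem QK_of_standard_module_free_of_rank_one
    (H : Type*) [AddCommGroup H] [Module ℤ H] [Module.Free ℤ H] [Module.Finite ℤ H]
    (V : Submodule ℤ H) [NoZeroSMulDivisors ℤ (H ⧸ V)]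
    (K : Submodule (LaurentPolynomial ℤ) (Mst H))
    (hK : (K : Set (Mst H)) = {x : Mst H | ∀ v ∈ V, MstAct H v x = 0})
    (N : Submodule (LaurentPolynomial ℤ) K)
    (hN : (N : Set K) =
      ↑(AddSubgroup.closure {z : K | ∃ w : H, ∃ y : K, (z : Mst H) = MstAct H w y})) :
    Nonempty ((K ⧸ N) ≃ₗ[LaurentPolynomial ℤ] LaurentPolynomial ℤ) := by
  have : @Module.IsTorsionFree ℤ (H ⧸ V) _ _ (Submodule.Quotient.module V) := by
    rw [Subsingleton.elim (Submodule.Quotient.module V) (AddCommGroup.toIntModule (H ⧸ V))]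
    infer_instance
  obtain ⟨m, n, b, hb⟩ := V.exists_basis_sum_span_inl_eq
  have hK' (x : Mst H) : x ∈ K ↔ ∀ v ∈ V, MstAct H v x = 0 := Set.ext_iff.1 hK x
  classical
  refine (isFermionic_mst b).nonempty_quotient_equiv (ε := mstAug H)
    (vac := (1 : LaurentPolynomial ℤ) ⊗ₜ[ℤ] (1 : ExteriorAlgebra ℤ _))
    (fun i => mstAct_one _ _) (mstAug_tmul_one 1) (fun z => eq_mstAug_smul b) ?_ N ?_ ?_
  · intro x
    rw [hK']
    constructor
    · intro hx i
      exact hx _ (hb ▸ Submodule.subset_span ⟨i, rfl⟩)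
    · intro hx v hv
      rw [← hb] at hv
      obtain ⟨r, rfl⟩ := (Submodule.mem_span_range_iff_exists_fun ℤ).1 hv
      change mstOrbit x _ = 0
      rw [map_sum]
      refine Finset.sum_eq_zero fun i _ => ?_
      rw [LinearMap.map_smul, show mstOrbit x ((b ∘ Sum.inl) i) = 0 from hx i, smul_zero]
  · intro i x y hy
    rw [← SetLike.mem_coe, hN]
    exact AddSubgroup.subset_closure ⟨b i, x, hy⟩
  · intro f hf y hy
    rw [← SetLike.mem_coe, hN, SetLike.mem_coe] at hy
    induction hy using AddSubgroup.closure_induction with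
    | mem z hz =>
      obtain ⟨w, y, hz⟩ := hz
      rw [hz]
      change f (mstOrbit y w) = 0
      rw [← b.sum_repr w, map_sum, map_sum]
      refine Finset.sum_eq_zero fun i _ => ?_
      rw [LinearMap.map_smul, map_zsmul, show f (mstOrbit y (b i)) = 0 from hf i y y.2, smul_zero]
    | zero => simp
    | add x y _ _ hx hy => rw [Submodule.coe_add, map_add, hx, hy, add_zero]
    | neg x _ hx => rw [Submodule.coe_neg, map_neg, hx, neg_zero]
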